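/- The flatness of Riemann's non-differentiable function in the sense of structure functions tends to infinity: lim_{ℓ→0⁺} G_R(ℓ) = +∞, where G_R(ℓ) = S₄(ℓ) / S₂(ℓ)². In other words, Riemann's non-differentiable function is intermittent in the sense of structure functions. -/

import Mathlib

open Real MeasureTheory

/-- `σ k = 1` if `k` is a perfect square, `0` otherwise. -/
noncomputable def sqIndicator (k : ℕ) : ℝ := if IsSquare k then 1 else 0

/-- The character `e_k(x) = e^{2πikx}`. -/
noncomputable def eChar (k : ℕ) (x : ℝ) : ℂ :=
  Complex.exp (2 * Real.pi * Complex.I * (k : ℂ) * (x : ℂ))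

/-- Riemann's non-differentiable function `R(x) = ∑_{k≥1} (σ_k/k) e^{2πikx}
    = ∑_{n≥1} e^{2πin²x}/n²`. -/
noncomputable def RiemannF (x : ℝ) : ℂ :=
  ∑' k : ℕ, ((sqIndicator k / k : ℝ) : ℂ) * eChar k x

/-- High-pass filter `R_{≥N}(x) = ∑_{k ≥ N} (σ_k/k) e^{2πikx}`. -/
noncomputable def RiemannHigh (N : ℕ) (x : ℝ) : ℂ :=
  ∑' k : ℕ, if N ≤ k then ((sqIndicator k / k : ℝ) : ℂ) * eChar k x else 0

/-- The structure function `S_p(ℓ) = ∫₀¹ |R(x+ℓ) − R(x)|^p dx` (for natural `p`). -/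
noncomputable def structureFn (p : ℕ) (ℓ : ℝ) : ℝ :=
  ∫ x in (0:ℝ)..1, ‖RiemannF (x + ℓ) - RiemannF x‖ ^ p

/-- The flatness in the sense of structure functions, `G_R(ℓ) = S₄(ℓ)/S₂(ℓ)²`. -/
noncomputable def flatnessSF (ℓ : ℝ) : ℝ := structureFn 4 ℓ / (structureFn 2 ℓ) ^ 2

/-- The representations of `m` as an ordered sum of two positive squares, recorded by their summands. -/
def squarePairs (m : ℕ) : Finset (ℕ × ℕ) :=
  (Finset.HasAntidiagonal.antidiagonal m).filter fun x => 0 < x.1 ∧ 0 < x.2 ∧ IsSquare x.1 ∧ IsSquare x.2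

/-- Parameters `(p, q, r, s)`, `p` prime, of solutions of `a² + b² = c² + d²`. -/
def squarePairParams (K N : ℕ) : Finset (Σ _ : ℕ, ℕ × ℕ × ℕ) :=
  ((Finset.range K).filter Nat.Prime).sigma fun p =>
    Finset.Icc 1 (p / 2) ×ˢ (Finset.Ioc (N / p) (2 * (N / p)) ×ˢ Finset.Ioc (N / p) (2 * (N / p)))

/-- The solution `(pr + qs)² + (ps - qr)² = (pr - qs)² + (ps + qr)²`. -/
def squarePairMap (x : Σ _ : ℕ, ℕ × ℕ × ℕ) : Σ _ : ℕ, (ℕ × ℕ) × (ℕ × ℕ) :=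
  ⟨(x.1 * x.2.2.1 + x.2.1 * x.2.2.2) ^ 2 + (x.1 * x.2.2.2 - x.2.1 * x.2.2.1) ^ 2,
    (((x.1 * x.2.2.1 + x.2.1 * x.2.2.2) ^ 2, (x.1 * x.2.2.2 - x.2.1 * x.2.2.1) ^ 2),
      ((x.1 * x.2.2.1 - x.2.1 * x.2.2.2) ^ 2, (x.1 * x.2.2.2 + x.2.1 * x.2.2.1) ^ 2))⟩

lemma mem_squarePairParams {K N p q r s : ℕ} :
    (⟨p, q, r, s⟩ : Σ _ : ℕ, ℕ × ℕ × ℕ) ∈ squarePairParams K N ↔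
      (p < K ∧ p.Prime) ∧ (1 ≤ q ∧ q ≤ p / 2) ∧ (N / p < r ∧ r ≤ 2 * (N / p)) ∧
        (N / p < s ∧ s ≤ 2 * (N / p)) := by
  simp [squarePairParams]

lemma mul_lt_mul_of_squarePairParams {p q r s T : ℕ} (hp : 0 < p) (hq : q ≤ p / 2)
    (hr : T < r) (hs : s ≤ 2 * T) : q * s < p * r :=
  calc q * s ≤ q * (2 * T) := by gcongr
    _ = 2 * q * T := by ring
    _ ≤ p * T := by gcongr; omega
    _ < p * r := by gcongr

lemma squarePairMap_mapsTo (K N : ℕ) :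
    Set.MapsTo squarePairMap (squarePairParams K N)
      ((Finset.range (16 * N ^ 2 + 1)).sigma fun m => squarePairs m ×ˢ squarePairs m) := by
  rintro ⟨p, q, r, s⟩ hx
  obtain ⟨⟨-, hp⟩, ⟨hq, hqp⟩, ⟨hr, hr'⟩, ⟨hs, hs'⟩⟩ := mem_squarePairParams.1 hx
  have h₁ : q * s < p * r := mul_lt_mul_of_squarePairParams hp.pos hqp hr hs'
  have h₂ : q * r < p * s := mul_lt_mul_of_squarePairParams hp.pos hqp hs hr'
  have hpT : p * (N / p) ≤ N := Nat.mul_div_le N p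
  have hpr : p * r ≤ 2 * N := by nlinarith
  have hps : p * s ≤ 2 * N := by nlinarith
  obtain ⟨u, hu⟩ := Nat.exists_eq_add_of_lt h₁
  obtain ⟨v, hv⟩ := Nat.exists_eq_add_of_lt h₂
  have hu' : p * r - q * s = u + 1 := by omega
  have hv' : p * s - q * r = v + 1 := by omega
  have hnorm : (p * r + q * s) ^ 2 + (v + 1) ^ 2 = (u + 1) ^ 2 + (p * s + q * r) ^ 2 := by
    zify at hu hv ⊢
    have e₁ : (u : ℤ) + 1 = p * r - q * s := by linarith
    have e₂ : (v : ℤ) + 1 = p * s - q * r := by linarith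
    rw [e₁, e₂]
    ring
  have hpos : 0 < p * r := by omega
  have hpos' : 0 < p * s := by omega
  have hle : (p * r + q * s) ^ 2 + (v + 1) ^ 2 ≤ 16 * N ^ 2 := by
    have h2q : 2 * q ≤ p := by omega
    have hqr : 2 * (q * r) ≤ 2 * N := by nlinarith
    have hqs : 2 * (q * s) ≤ 2 * N := by nlinarith
    have ha : p * r + q * s ≤ 3 * N := by omega
    have hb : v + 1 ≤ 2 * N := by omega
    nlinarith [Nat.pow_le_pow_left ha 2, Nat.pow_le_pow_left hb 2]
  simp only [squarePairMap, squarePairs, Finset.coe_sigma, Set.mem_sigma_iff, Finset.mem_coe,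
    Finset.mem_range, Finset.mem_product, Finset.mem_filter, Finset.HasAntidiagonal.mem_antidiagonal, hu', hv']
  refine ⟨by omega, ⟨trivial, ?_, ?_, IsSquare.sq _, IsSquare.sq _⟩, hnorm.symm, ?_, ?_,
    IsSquare.sq _, IsSquare.sq _⟩ <;> positivity

lemma squarePairMap_injOn (K N : ℕ) : Set.InjOn squarePairMap (squarePairParams K N) := by
  rintro ⟨p, q, r, s⟩ hx ⟨p', q', r', s'⟩ hx' h
  obtain ⟨⟨-, hp⟩, ⟨hq, hqp⟩, ⟨hr₁, hr₂⟩, ⟨hs₁, hs₂⟩⟩ := mem_squarePairParams.1 hx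
  obtain ⟨⟨-, hp'⟩, ⟨hq', hqp'⟩, ⟨hr₁', hr₂'⟩, ⟨hs₁', hs₂'⟩⟩ := mem_squarePairParams.1 hx'
  have h₁ : q * s < p * r := mul_lt_mul_of_squarePairParams hp.pos hqp hr₁ hs₂
  have h₂ : q * r < p * s := mul_lt_mul_of_squarePairParams hp.pos hqp hs₁ hr₂
  have h₁' : q' * s' < p' * r' := mul_lt_mul_of_squarePairParams hp'.pos hqp' hr₁' hs₂'
  have h₂' : q' * r' < p' * s' := mul_lt_mul_of_squarePairParams hp'.pos hqp' hs₁' hr₂'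
  simp only [squarePairMap, Sigma.mk.injEq, heq_eq_eq, Prod.mk.injEq,
    Nat.pow_left_inj (two_ne_zero)] at h
  obtain ⟨-, ⟨ha, hb⟩, hc, hd⟩ := h
  have hpr : p * r = p' * r' := by omega
  have hqr : q * r = q' * r' := by omega
  have hps : p * s = p' * s' := by omega
  have hr0 : 0 < r := by omega
  have hr0' : 0 < r' := by omega
  have hcross : p * q' = p' * q := by
    refine Nat.eq_of_mul_eq_mul_right (Nat.mul_pos hr0 hr0') ?_
    calc p * q' * (r * r') = (p * r) * (q' * r') := by ring
      _ = (p' * r') * (q * r) := by rw [hpr, hqr]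
      _ = p' * q * (r * r') := by ring
  have hpp : p = p' := by
    have hdvd : p ∣ p' * q := ⟨q', hcross.symm⟩
    rcases hp.dvd_mul.1 hdvd with hd | hd
    · exact (Nat.prime_dvd_prime_iff_eq hp hp').1 hd
    · have := Nat.le_of_dvd (by omega) hd
      have := hp.two_le
      omega
  subst hpp
  have hqq : q = q' := (Nat.eq_of_mul_eq_mul_left hp.pos hcross).symm
  have hrr : r = r' := Nat.eq_of_mul_eq_mul_left hp.pos hpr
  have hss : s = s' := Nat.eq_of_mul_eq_mul_left hp.pos hps
  subst hqq hrr hss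
  rfl

lemma card_squarePairParams (K N : ℕ) :
    (squarePairParams K N).card =
      ∑ p ∈ (Finset.range K).filter Nat.Prime, p / 2 * (N / p * (N / p)) := by
  rw [squarePairParams, Finset.card_sigma]
  refine Finset.sum_congr rfl fun p _ => ?_
  simp [two_mul]

lemma card_squarePairParams_le (K N : ℕ) :
    (squarePairParams K N).card ≤ ∑ m ∈ Finset.range (16 * N ^ 2 + 1), (squarePairs m).card ^ 2 := by
  refine (Finset.card_le_card_of_injOn squarePairMap (squarePairMap_mapsTo K N)
    (squarePairMap_injOn K N)).trans_eq ?_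
  simp [Finset.card_sigma, sq]

/-- The second moment of the number of representations as a sum of two squares grows faster than
the length of the range. -/
lemma sum_card_squarePairs_sq_ge {K N : ℕ} (hKN : K ≤ N) :
    (N : ℝ) ^ 2 / 12 * ∑ p ∈ (Finset.range K).filter Nat.Prime, (1 / p : ℝ) ≤
      ∑ m ∈ Finset.range (16 * N ^ 2 + 1), ((squarePairs m).card : ℝ) ^ 2 := by
  have h : ((squarePairParams K N).card : ℝ) ≤
      ∑ m ∈ Finset.range (16 * N ^ 2 + 1), ((squarePairs m).card : ℝ) ^ 2 := by
    exact_mod_cast card_squarePairParams_le K N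
  refine le_trans ?_ h
  rw [card_squarePairParams, Finset.mul_sum]
  push_cast
  refine Finset.sum_le_sum fun p hp => ?_
  obtain ⟨hpK, hp⟩ := Finset.mem_filter.1 hp
  have hpN : p ≤ N := (Finset.mem_range.1 hpK).le.trans hKN
  have hp0 : (0 : ℝ) < p := by exact_mod_cast hp.pos
  have h₁ : (p : ℝ) / 3 ≤ ((p / 2 : ℕ) : ℝ) := by
    have h3 : p ≤ 3 * (p / 2) := by
      have := hp.two_le
      omega
    have : (p : ℝ) ≤ 3 * ((p / 2 : ℕ) : ℝ) := by exact_mod_cast h3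
    linarith
  have h₂ : (N : ℝ) / (2 * p) ≤ ((N / p : ℕ) : ℝ) := by
    have hT : 1 ≤ N / p := (Nat.one_le_div_iff hp.pos).2 hpN
    have hmod := Nat.div_add_mod N p
    have hlt := Nat.mod_lt N hp.pos
    have hN : N ≤ 2 * p * (N / p) := by nlinarith
    rw [div_le_iff₀ (by positivity)]
    calc (N : ℝ) ≤ ((2 * p * (N / p) : ℕ) : ℝ) := by exact_mod_cast hN
      _ = _ := by push_cast; ring
  calc (N : ℝ) ^ 2 / 12 * (1 / p) = p / 3 * (N / (2 * p) * (N / (2 * p))) := by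
        field_simp
        ring
    _ ≤ _ := by
        gcongr

lemma continuous_eChar (k : ℕ) : Continuous (eChar k) := by
  unfold eChar
  fun_prop

lemma norm_eChar (k : ℕ) (x : ℝ) : ‖eChar k x‖ = 1 := by
  have h : 2 * (π : ℂ) * Complex.I * (k : ℂ) * (x : ℂ) = ((2 * π * k * x : ℝ) : ℂ) * Complex.I := by
    push_cast
    ring
  rw [eChar, h, Complex.norm_exp_ofReal_mul_I]

lemma eChar_add_right (k : ℕ) (x y : ℝ) : eChar k (x + y) = eChar k x * eChar k y := by
  rw [eChar, eChar, eChar, ← Complex.exp_add]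
  push_cast
  ring_nf

lemma eChar_add_left (k l : ℕ) (x : ℝ) : eChar (k + l) x = eChar k x * eChar l x := by
  rw [eChar, eChar, eChar, ← Complex.exp_add]
  push_cast
  ring_nf

lemma integral_eChar_mul_conj (j k : ℕ) :
    ∫ x in (0 : ℝ)..1, eChar j x * (starRingEnd ℂ) (eChar k x) = if j = k then 1 else 0 := by
  have h : ∀ x : ℝ, eChar j x * (starRingEnd ℂ) (eChar k x) =
      Complex.exp (((j - k : ℤ) : ℂ) * (2 * π * Complex.I) * x) := by
    intro x
    rw [eChar, eChar, ← Complex.exp_conj, ← Complex.exp_add]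
    simp only [map_mul, Complex.conj_I, Complex.conj_ofReal, map_natCast, map_ofNat]
    push_cast
    ring_nf
  simp only [h]
  split_ifs with hjk
  · simp [hjk]
  · have hne : ((j - k : ℤ) : ℂ) * (2 * π * Complex.I) ≠ 0 :=
      mul_ne_zero (Int.cast_ne_zero.2 (sub_ne_zero.2 (Nat.cast_injective.ne hjk)))
        Complex.two_pi_I_ne_zero
    rw [integral_exp_mul_complex hne]
    simp only [Complex.ofReal_one, mul_one, Complex.ofReal_zero, mul_zero, Complex.exp_zero,
      Complex.exp_int_mul_two_pi_mul_I, sub_self, zero_div]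

/-- Parseval's identity for absolutely convergent trigonometric series. -/
lemma hasSum_norm_sq_integral_tsum_eChar {b : ℕ → ℂ} (hb : Summable fun k => ‖b k‖) :
    HasSum (fun k => ‖b k‖ ^ 2) (∫ x in (0 : ℝ)..1, ‖∑' k, b k * eChar k x‖ ^ 2) := by
  have hsum : ∀ x, Summable fun k => ‖b k * eChar k x‖ := by
    intro x
    simpa [norm_eChar] using hb
  have hsum' : ∀ x, Summable fun k => ‖(starRingEnd ℂ) (b k * eChar k x)‖ := by
    intro x
    simpa [norm_eChar] using hb
  have hbb : Summable fun z : ℕ × ℕ => ‖b z.1‖ * ‖b z.2‖ :=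
    Summable.mul_of_nonneg hb hb (fun _ => norm_nonneg _) fun _ => norm_nonneg _
  have key : HasSum (fun z : ℕ × ℕ => ∫ x in (0 : ℝ)..1,
      (b z.1 * eChar z.1 x) * (starRingEnd ℂ) (b z.2 * eChar z.2 x))
      (∫ x in (0 : ℝ)..1, ((‖∑' k, b k * eChar k x‖ ^ 2 : ℝ) : ℂ)) := by
    refine intervalIntegral.hasSum_integral_of_dominated_convergence
      (fun z _ => ‖b z.1‖ * ‖b z.2‖) (fun z => ?_) (fun z => ?_) ?_ ?_ ?_
    · have h₁ := continuous_eChar z.1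
      have h₂ := continuous_eChar z.2
      exact (by fun_prop : Continuous fun x => (b z.1 * eChar z.1 x) *
        (starRingEnd ℂ) (b z.2 * eChar z.2 x)).aestronglyMeasurable
    · refine Filter.Eventually.of_forall fun x _ => le_of_eq ?_
      simp [norm_eChar]
    · exact Filter.Eventually.of_forall fun x _ => hbb
    · exact intervalIntegrable_const
    · refine Filter.Eventually.of_forall fun x _ => ?_
      have h := tsum_mul_tsum_of_summable_norm (hsum x) (hsum' x)
      rw [← Complex.conj_tsum, Complex.mul_conj, Complex.normSq_eq_norm_sq] at h
      rw [h]
      exact (summable_mul_of_summable_norm (hsum x) (hsum' x)).hasSum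
  have hterm : ∀ z : ℕ × ℕ, ∫ x in (0 : ℝ)..1,
      (b z.1 * eChar z.1 x) * (starRingEnd ℂ) (b z.2 * eChar z.2 x) =
        if z.1 = z.2 then ((‖b z.1‖ ^ 2 : ℝ) : ℂ) else 0 := by
    intro z
    have h : ∀ x, (b z.1 * eChar z.1 x) * (starRingEnd ℂ) (b z.2 * eChar z.2 x) =
        (b z.1 * (starRingEnd ℂ) (b z.2)) * (eChar z.1 x * (starRingEnd ℂ) (eChar z.2 x)) := by
      intro x
      rw [map_mul]
      ring
    simp only [h, intervalIntegral.integral_const_mul, integral_eChar_mul_conj]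
    split_ifs with hz
    · rw [← hz, Complex.mul_conj, Complex.normSq_eq_norm_sq, mul_one]
    · simp
  simp only [hterm, intervalIntegral.integral_ofReal] at key
  have hdiag : Function.Injective fun k : ℕ => (k, k) := fun _ _ h => (Prod.mk.inj h).1
  rw [← hdiag.hasSum_iff] at key
  · rw [← Complex.hasSum_ofReal]
    simpa [Function.comp_def] using key
  · rintro ⟨i, j⟩ hij
    refine if_neg fun h => hij ⟨i, ?_⟩
    simp only at h
    rw [h]

/-- The Fourier coefficients of the increment `R(x + ℓ) - R(x)`. -/
noncomputable def incrCoeff (ℓ : ℝ) (k : ℕ) : ℂ :=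
  ((sqIndicator k / k : ℝ) : ℂ) * (eChar k ℓ - 1)

lemma sqIndicator_nonneg (k : ℕ) : 0 ≤ sqIndicator k := by
  unfold sqIndicator
  split_ifs <;> norm_num

lemma sqIndicator_sq (n : ℕ) : sqIndicator (n ^ 2) = 1 := if_pos (IsSquare.sq n)

lemma sqIndicator_of_notMem_range {k : ℕ} (hk : k ∉ Set.range fun n : ℕ => n ^ 2) :
    sqIndicator k = 0 := by
  refine if_neg fun h => hk ?_
  obtain ⟨r, hr⟩ := h
  exact ⟨r, by simp [hr, sq]⟩

lemma injective_sq_nat : Function.Injective fun n : ℕ => n ^ 2 :=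
  Nat.pow_left_injective two_ne_zero

lemma summable_sqIndicator_div : Summable fun k : ℕ => sqIndicator k / k := by
  rw [← injective_sq_nat.summable_iff]
  · have h : ((fun k : ℕ => sqIndicator k / k) ∘ fun n : ℕ => n ^ 2) =
        fun n : ℕ => 1 / (n : ℝ) ^ 2 := by
      ext n
      simp [sqIndicator_sq]
    rw [h]
    exact Real.summable_one_div_nat_pow.2 one_lt_two
  · intro k hk
    simp [sqIndicator_of_notMem_range hk]

lemma norm_eChar_sub_one (k : ℕ) (ℓ : ℝ) : ‖eChar k ℓ - 1‖ = |2 * sin (π * k * ℓ)| := by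
  have h : 2 * (π : ℂ) * Complex.I * (k : ℂ) * (ℓ : ℂ) =
      Complex.I * ((2 * π * k * ℓ : ℝ) : ℂ) := by
    push_cast
    ring
  rw [eChar, h, Complex.norm_exp_I_mul_ofReal_sub_one, Real.norm_eq_abs]
  ring_nf

lemma norm_incrCoeff (ℓ : ℝ) (k : ℕ) :
    ‖incrCoeff ℓ k‖ = sqIndicator k / k * |2 * sin (π * k * ℓ)| := by
  rw [incrCoeff, norm_mul, norm_eChar_sub_one, Complex.norm_real, Real.norm_eq_abs,
    abs_of_nonneg (div_nonneg (sqIndicator_nonneg k) k.cast_nonneg)]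

lemma summable_norm_incrCoeff (ℓ : ℝ) : Summable fun k => ‖incrCoeff ℓ k‖ := by
  refine Summable.of_nonneg_of_le (fun _ => norm_nonneg _) (fun k => ?_)
    (summable_sqIndicator_div.mul_right 2)
  rw [norm_incrCoeff, abs_mul, abs_two]
  have h := div_nonneg (sqIndicator_nonneg k) (k.cast_nonneg (α := ℝ))
  gcongr
  linarith [abs_sin_le_one (π * k * ℓ)]

lemma RiemannF_add_sub (ℓ x : ℝ) :
    RiemannF (x + ℓ) - RiemannF x = ∑' k, incrCoeff ℓ k * eChar k x := by
  have h : ∀ y, Summable fun k : ℕ => ((sqIndicator k / k : ℝ) : ℂ) * eChar k y := by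
    intro y
    refine Summable.of_norm ?_
    simpa only [norm_mul, norm_eChar, mul_one, Complex.norm_real] using
      summable_sqIndicator_div.norm
  rw [RiemannF, RiemannF, ← (h _).tsum_sub (h _)]
  refine tsum_congr fun k => ?_
  rw [eChar_add_right, incrCoeff]
  ring

lemma hasSum_structureFn_two (ℓ : ℝ) :
    HasSum (fun k => ‖incrCoeff ℓ k‖ ^ 2) (structureFn 2 ℓ) := by
  simpa only [structureFn, RiemannF_add_sub] using
    hasSum_norm_sq_integral_tsum_eChar (summable_norm_incrCoeff ℓ)

lemma hasSum_structureFn_four (ℓ : ℝ) :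
    HasSum (fun m => ‖∑ z ∈ Finset.HasAntidiagonal.antidiagonal m, incrCoeff ℓ z.1 * incrCoeff ℓ z.2‖ ^ 2)
      (structureFn 4 ℓ) := by
  have hs := summable_norm_incrCoeff ℓ
  have h := hasSum_norm_sq_integral_tsum_eChar
    (summable_norm_sum_mul_antidiagonal_of_summable_norm hs hs)
  convert h using 1
  refine intervalIntegral.integral_congr fun x _ => ?_
  have hx : Summable fun k => ‖incrCoeff ℓ k * eChar k x‖ := by
    simpa [norm_eChar] using hs
  simp only [RiemannF_add_sub]
  rw [show (4 : ℕ) = 2 * 2 from rfl, pow_mul, ← norm_pow, sq (∑' k, _),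
    tsum_mul_tsum_eq_tsum_sum_antidiagonal_of_summable_norm hx hx]
  congr 3
  ext m
  rw [Finset.sum_mul]
  refine Finset.sum_congr rfl fun z hz => ?_
  rw [← Finset.HasAntidiagonal.mem_antidiagonal.1 hz, eChar_add_left]
  ring

lemma norm_incrCoeff_sq_le_const {ℓ : ℝ} (hℓ : 0 ≤ ℓ) (n : ℕ) :
    ‖incrCoeff ℓ (n ^ 2)‖ ^ 2 ≤ 49 * ℓ ^ 2 := by
  have h : ‖incrCoeff ℓ (n ^ 2)‖ ≤ 7 * ℓ := by
    rw [norm_incrCoeff, sqIndicator_sq]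
    rcases Nat.eq_zero_or_pos n with rfl | hn
    · simpa using hℓ
    · have hn' : (0 : ℝ) < n := by exact_mod_cast hn
      have hsin : |sin (π * (n ^ 2 : ℕ) * ℓ)| ≤ π * (n ^ 2 : ℕ) * ℓ :=
        abs_sin_le_abs.trans_eq (abs_of_nonneg (by positivity))
      rw [abs_mul, abs_two, div_mul_eq_mul_div, one_mul, div_le_iff₀ (by positivity)]
      have h0 : (0 : ℝ) ≤ ℓ * (n ^ 2 : ℕ) := by positivity
      nlinarith [pi_lt_d2]
  calc ‖incrCoeff ℓ (n ^ 2)‖ ^ 2 ≤ (7 * ℓ) ^ 2 := by gcongr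
    _ = 49 * ℓ ^ 2 := by ring

lemma norm_incrCoeff_sq_le_inv (ℓ : ℝ) (n : ℕ) :
    ‖incrCoeff ℓ (n ^ 2)‖ ^ 2 ≤ 4 * (((n : ℝ) ^ 2)⁻¹ * ((n : ℝ) ^ 2)⁻¹) := by
  have h : ‖incrCoeff ℓ (n ^ 2)‖ ≤ 2 * ((n : ℝ) ^ 2)⁻¹ := by
    rw [norm_incrCoeff, sqIndicator_sq, abs_mul, abs_two, Nat.cast_pow, one_div, mul_comm]
    gcongr
    linarith [abs_sin_le_one (π * (n : ℝ) ^ 2 * ℓ)]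
  calc ‖incrCoeff ℓ (n ^ 2)‖ ^ 2 ≤ (2 * ((n : ℝ) ^ 2)⁻¹) ^ 2 := by gcongr
    _ = _ := by ring

lemma structureFn_two_le {ℓ : ℝ} {N : ℕ} (hℓ : 0 ≤ ℓ) (hN : 1 ≤ N)
    (hNℓ : 36 * (N : ℝ) ^ 2 * ℓ ≤ 1) : structureFn 2 ℓ ≤ 9 / (N : ℝ) ^ 3 := by
  have hN' : (1 : ℝ) ≤ N := by exact_mod_cast hN
  have hN0 : (0 : ℝ) < N := by linarith
  rw [← (hasSum_structureFn_two ℓ).tsum_eq, ← injective_sq_nat.tsum_eq]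
  swap
  · intro k hk
    by_contra hk'
    exact hk (by simp [norm_incrCoeff, sqIndicator_of_notMem_range hk'])
  refine Real.tsum_le_of_sum_range_le (fun n => by positivity) fun K => ?_
  have hsub : Finset.range K ⊆ Finset.range (N + 1) ∪ Finset.Ioo N K := by
    intro n hn
    simp only [Finset.mem_union, Finset.mem_range, Finset.mem_Ioo] at hn ⊢
    omega
  have hdisj : Disjoint (Finset.range (N + 1)) (Finset.Ioo N K) := by
    rw [Finset.disjoint_left]
    intro n hn
    simp only [Finset.mem_range, Finset.mem_Ioo] at hn ⊢
    omega
  have hlow : ∑ n ∈ Finset.range (N + 1), ‖incrCoeff ℓ (n ^ 2)‖ ^ 2 ≤ 1 / (N : ℝ) ^ 3 := by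
    have hℓ' : ℓ ≤ 1 / (36 * (N : ℝ) ^ 2) := by
      rw [le_div_iff₀ (by positivity)]
      linarith
    calc ∑ n ∈ Finset.range (N + 1), ‖incrCoeff ℓ (n ^ 2)‖ ^ 2
        ≤ ∑ n ∈ Finset.range (N + 1), 49 * ℓ ^ 2 :=
          Finset.sum_le_sum fun n _ => norm_incrCoeff_sq_le_const hℓ n
      _ = (N + 1) * (49 * ℓ ^ 2) := by simp
      _ ≤ (2 * N) * (49 * (1 / (36 * (N : ℝ) ^ 2)) ^ 2) := by
          gcongr
          linarith
      _ = 98 / 1296 * (1 / (N : ℝ) ^ 3) := by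
          field_simp
          ring
      _ ≤ 1 / (N : ℝ) ^ 3 := by
          have : (0 : ℝ) ≤ 1 / (N : ℝ) ^ 3 := by positivity
          linarith
  have hhigh : ∑ n ∈ Finset.Ioo N K, ‖incrCoeff ℓ (n ^ 2)‖ ^ 2 ≤ 8 / (N : ℝ) ^ 3 := by
    calc ∑ n ∈ Finset.Ioo N K, ‖incrCoeff ℓ (n ^ 2)‖ ^ 2
        ≤ ∑ n ∈ Finset.Ioo N K, 4 * ((N : ℝ) ^ 2)⁻¹ * ((n : ℝ) ^ 2)⁻¹ := by
          refine Finset.sum_le_sum fun n hn => (norm_incrCoeff_sq_le_inv ℓ n).trans ?_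
          have hNn : (N : ℝ) ≤ n := by exact_mod_cast (Finset.mem_Ioo.1 hn).1.le
          rw [mul_assoc]
          gcongr
      _ = 4 * ((N : ℝ) ^ 2)⁻¹ * ∑ n ∈ Finset.Ioo N K, ((n : ℝ) ^ 2)⁻¹ := by
          rw [Finset.mul_sum]
      _ ≤ 4 * ((N : ℝ) ^ 2)⁻¹ * (2 / N) := by
          gcongr
          refine (sum_Ioo_inv_sq_le N K).trans ?_
          gcongr
          linarith
      _ = 8 / (N : ℝ) ^ 3 := by
          field_simp
          norm_num
  calc ∑ n ∈ Finset.range K, ‖incrCoeff ℓ (n ^ 2)‖ ^ 2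
      ≤ ∑ n ∈ Finset.range (N + 1) ∪ Finset.Ioo N K, ‖incrCoeff ℓ (n ^ 2)‖ ^ 2 :=
        Finset.sum_le_sum_of_subset_of_nonneg hsub fun _ _ _ => by positivity
    _ ≤ 1 / (N : ℝ) ^ 3 + 8 / (N : ℝ) ^ 3 := by
        rw [Finset.sum_union hdisj]
        exact add_le_add hlow hhigh
    _ = 9 / (N : ℝ) ^ 3 := by ring

lemma structureFn_two_pos {ℓ : ℝ} (hℓ : 0 < ℓ) (hℓ' : ℓ < 1) : 0 < structureFn 2 ℓ := by
  refine lt_of_lt_of_le ?_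
    (le_hasSum (hasSum_structureFn_two ℓ) 1 fun _ _ => by positivity)
  have h1 : sqIndicator 1 = 1 := sqIndicator_sq 1
  have hsin : 0 < sin (π * ℓ) :=
    sin_pos_of_pos_of_lt_pi (by positivity) (by nlinarith [pi_pos])
  rw [norm_incrCoeff, h1]
  simp only [Nat.cast_one, div_one, one_mul, mul_one]
  positivity

/-- The real amplitude of `incrCoeff ℓ k`. -/
noncomputable def incrAmplitude (ℓ : ℝ) (k : ℕ) : ℝ :=
  sqIndicator k / k * (2 * sin (π * k * ℓ))

lemma incrCoeff_eq (ℓ : ℝ) (k : ℕ) :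
    incrCoeff ℓ k =
      incrAmplitude ℓ k * (Complex.I * Complex.exp (((π * k * ℓ : ℝ) : ℂ) * Complex.I)) := by
  set θ : ℝ := π * k * ℓ with hθ
  have h : eChar k ℓ = Complex.exp (θ * Complex.I) * Complex.exp (θ * Complex.I) := by
    rw [eChar, ← Complex.exp_add, hθ]
    push_cast
    ring_nf
  have hinv : Complex.exp (-θ * Complex.I) * Complex.exp (θ * Complex.I) = 1 := by
    rw [← Complex.exp_add]
    simp
  rw [incrCoeff, incrAmplitude, h, ← hθ]
  push_cast
  rw [Complex.sin]
  linear_combination (sqIndicator k / k : ℂ) * hinv -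
    (sqIndicator k / k : ℂ) * (Complex.exp (-θ * Complex.I) * Complex.exp (θ * Complex.I) -
      Complex.exp (θ * Complex.I) * Complex.exp (θ * Complex.I)) * Complex.I_sq

lemma norm_sum_antidiagonal_incrCoeff (ℓ : ℝ) (m : ℕ) :
    ‖∑ z ∈ Finset.HasAntidiagonal.antidiagonal m, incrCoeff ℓ z.1 * incrCoeff ℓ z.2‖ =
      |∑ z ∈ Finset.HasAntidiagonal.antidiagonal m,
        incrAmplitude ℓ z.1 * incrAmplitude ℓ z.2| := by
  have h : ∑ z ∈ Finset.HasAntidiagonal.antidiagonal m, incrCoeff ℓ z.1 * incrCoeff ℓ z.2 =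
      ((∑ z ∈ Finset.HasAntidiagonal.antidiagonal m,
        incrAmplitude ℓ z.1 * incrAmplitude ℓ z.2 : ℝ) : ℂ) *
          (-Complex.exp (((π * m * ℓ : ℝ) : ℂ) * Complex.I)) := by
    push_cast
    rw [Finset.sum_mul]
    refine Finset.sum_congr rfl fun z hz => ?_
    have hexp : Complex.exp (((π * m * ℓ : ℝ) : ℂ) * Complex.I) =
        Complex.exp (((π * z.1 * ℓ : ℝ) : ℂ) * Complex.I) *
          Complex.exp (((π * z.2 * ℓ : ℝ) : ℂ) * Complex.I) := by
      rw [← Complex.exp_add, ← Finset.HasAntidiagonal.mem_antidiagonal.1 hz]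
      push_cast
      ring_nf
    push_cast at hexp
    rw [incrCoeff_eq, incrCoeff_eq, hexp]
    push_cast
    linear_combination (incrAmplitude ℓ z.1 : ℂ) * incrAmplitude ℓ z.2 *
      (Complex.exp (π * z.1 * ℓ * Complex.I) * Complex.exp (π * z.2 * ℓ * Complex.I)) *
        Complex.I_sq
  rw [h, norm_mul, norm_neg, Complex.norm_exp_ofReal_mul_I, mul_one, Complex.norm_real,
    Real.norm_eq_abs]

lemma incrAmplitude_nonneg {ℓ : ℝ} {k : ℕ} (hℓ : 0 ≤ ℓ) (hk : k * ℓ ≤ 1 / 2) :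
    0 ≤ incrAmplitude ℓ k := by
  have h := sqIndicator_nonneg k
  have hsin : 0 ≤ sin (π * k * ℓ) :=
    sin_nonneg_of_nonneg_of_le_pi (by positivity) (by nlinarith [pi_pos])
  unfold incrAmplitude
  positivity

lemma le_incrAmplitude {ℓ : ℝ} {k : ℕ} (hℓ : 0 ≤ ℓ) (hk : k * ℓ ≤ 1 / 2) (hk0 : 0 < k)
    (hsq : IsSquare k) : 4 * ℓ ≤ incrAmplitude ℓ k := by
  have hk' : (0 : ℝ) < k := by exact_mod_cast hk0
  have hsin := Real.mul_le_sin (x := π * k * ℓ) (by positivity) (by nlinarith [pi_pos])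
  have heq : 2 / π * (π * k * ℓ) = 2 * k * ℓ := by
    field_simp
  rw [heq] at hsin
  rw [incrAmplitude, sqIndicator, if_pos hsq, div_mul_eq_mul_div, le_div_iff₀ hk']
  linarith

lemma card_squarePairs_le_norm {ℓ : ℝ} {m : ℕ} (hℓ : 0 ≤ ℓ) (hm : m * ℓ ≤ 1 / 2) :
    16 * ℓ ^ 2 * (squarePairs m).card ≤
      ‖∑ z ∈ Finset.HasAntidiagonal.antidiagonal m, incrCoeff ℓ z.1 * incrCoeff ℓ z.2‖ := by
  have hz : ∀ z ∈ Finset.HasAntidiagonal.antidiagonal m, z.1 * ℓ ≤ 1 / 2 ∧ z.2 * ℓ ≤ 1 / 2 := by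
    intro z hz
    have hzm := Finset.HasAntidiagonal.mem_antidiagonal.1 hz
    have h₁ : (z.1 : ℝ) ≤ m := by exact_mod_cast (by omega : z.1 ≤ m)
    have h₂ : (z.2 : ℝ) ≤ m := by exact_mod_cast (by omega : z.2 ≤ m)
    exact ⟨(mul_le_mul_of_nonneg_right h₁ hℓ).trans hm,
      (mul_le_mul_of_nonneg_right h₂ hℓ).trans hm⟩
  rw [norm_sum_antidiagonal_incrCoeff]
  calc 16 * ℓ ^ 2 * (squarePairs m).card = ∑ _z ∈ squarePairs m, (4 * ℓ) * (4 * ℓ) := by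
        rw [Finset.sum_const, nsmul_eq_mul]
        ring
    _ ≤ ∑ z ∈ squarePairs m, incrAmplitude ℓ z.1 * incrAmplitude ℓ z.2 := by
        refine Finset.sum_le_sum fun z hzs => ?_
        obtain ⟨hzm, h₁, h₂, hs₁, hs₂⟩ := Finset.mem_filter.1 hzs
        obtain ⟨hz₁, hz₂⟩ := hz z hzm
        exact mul_le_mul (le_incrAmplitude hℓ hz₁ h₁ hs₁) (le_incrAmplitude hℓ hz₂ h₂ hs₂)
          (by positivity) (incrAmplitude_nonneg hℓ hz₁)
    _ ≤ ∑ z ∈ Finset.HasAntidiagonal.antidiagonal m,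
          incrAmplitude ℓ z.1 * incrAmplitude ℓ z.2 :=
        Finset.sum_le_sum_of_subset_of_nonneg (Finset.filter_subset _ _) fun z hzm _ =>
          mul_nonneg (incrAmplitude_nonneg hℓ (hz z hzm).1) (incrAmplitude_nonneg hℓ (hz z hzm).2)
    _ ≤ _ := le_abs_self _

lemma structureFn_four_ge {ℓ : ℝ} {K N : ℕ} (hℓ : 0 ≤ ℓ) (hKN : K ≤ N)
    (hNℓ : 36 * (N : ℝ) ^ 2 * ℓ ≤ 1) :
    256 * ℓ ^ 4 * ((N : ℝ) ^ 2 / 12 * ∑ p ∈ (Finset.range K).filter Nat.Prime, (1 / p : ℝ)) ≤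
      structureFn 4 ℓ := by
  refine le_trans ?_ (sum_le_hasSum (Finset.range (16 * N ^ 2 + 1)) (fun _ _ => by positivity)
    (hasSum_structureFn_four ℓ))
  refine (mul_le_mul_of_nonneg_left (sum_card_squarePairs_sq_ge hKN) (by positivity)).trans ?_
  rw [Finset.mul_sum]
  refine Finset.sum_le_sum fun m hm => ?_
  have hm' : (m : ℝ) ≤ 16 * (N : ℝ) ^ 2 := by
    exact_mod_cast Nat.lt_succ_iff.1 (Finset.mem_range.1 hm)
  have h := card_squarePairs_le_norm (m := m) hℓ (by nlinarith)
  calc 256 * ℓ ^ 4 * ((squarePairs m).card : ℝ) ^ 2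
      = (16 * ℓ ^ 2 * (squarePairs m).card) ^ 2 := by ring
    _ ≤ _ := by gcongr

lemma flatnessSF_ge {ℓ : ℝ} {K N : ℕ} (hN : 1 ≤ N) (hKN : K ≤ N)
    (hNℓ : 36 * (N : ℝ) ^ 2 * ℓ ≤ 1) (hNℓ' : 1 ≤ 36 * ((N : ℝ) + 1) ^ 2 * ℓ) :
    256 / (144 ^ 4 * 972) * ∑ p ∈ (Finset.range K).filter Nat.Prime, (1 / p : ℝ) ≤
      flatnessSF ℓ := by
  have hN' : (1 : ℝ) ≤ N := by exact_mod_cast hN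
  have hN0 : (0 : ℝ) < N := by linarith
  have hℓ : 0 < ℓ := by
    by_contra! hneg
    nlinarith [mul_nonpos_of_nonneg_of_nonpos (by positivity : 0 ≤ 36 * ((N : ℝ) + 1) ^ 2) hneg]
  have hℓ₁ : ℓ < 1 := by nlinarith
  have hℓN : 1 / (144 * (N : ℝ) ^ 2) ≤ ℓ := by
    rw [div_le_iff₀ (by positivity)]
    nlinarith [mul_le_mul_of_nonneg_right
      (by nlinarith : 36 * ((N : ℝ) + 1) ^ 2 ≤ 144 * (N : ℝ) ^ 2) hℓ.le]
  have hS₂ := structureFn_two_le hℓ.le hN hNℓ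
  have hS₂pos := structureFn_two_pos hℓ hℓ₁
  have hS₄ := structureFn_four_ge hℓ.le hKN hNℓ
  set H := ∑ p ∈ (Finset.range K).filter Nat.Prime, (1 / p : ℝ)
  have hH : 0 ≤ H := Finset.sum_nonneg fun _ _ => by positivity
  rw [flatnessSF, le_div_iff₀ (by positivity)]
  calc 256 / (144 ^ 4 * 972) * H * structureFn 2 ℓ ^ 2
      ≤ 256 / (144 ^ 4 * 972) * H * (9 / (N : ℝ) ^ 3) ^ 2 := by gcongr
    _ = 256 * (1 / (144 * (N : ℝ) ^ 2)) ^ 4 * ((N : ℝ) ^ 2 / 12 * H) := by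
        field_simp
        ring
    _ ≤ 256 * ℓ ^ 4 * ((N : ℝ) ^ 2 / 12 * H) := by gcongr
    _ ≤ structureFn 4 ℓ := hS₄

lemma tendsto_sum_one_div_primes :
    Filter.Tendsto (fun K => ∑ p ∈ (Finset.range K).filter Nat.Prime, (1 / p : ℝ))
      Filter.atTop Filter.atTop := by
  have h := (not_summable_iff_tendsto_nat_atTop_of_nonneg fun n =>
    Set.indicator_nonneg (fun _ _ => by positivity) n).1 not_summable_one_div_on_primes
  refine h.congr fun K => ?_
  rw [Finset.sum_filter]
  exact Finset.sum_congr rfl fun n _ => by simp [Set.indicator_apply]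

/-- Riemann's non-differentiable function is intermittent in the sense of
structure functions: `G_R(ℓ) → +∞` as `ℓ → 0⁺`. -/
theorem riemann_intermittent_SF :
    Filter.Tendsto flatnessSF (nhdsWithin 0 (Set.Ioi 0)) Filter.atTop := by
  refine Filter.tendsto_atTop.2 fun B => ?_
  obtain ⟨K, hK⟩ := ((tendsto_sum_one_div_primes.const_mul_atTop
    (by norm_num : (0 : ℝ) < 256 / (144 ^ 4 * 972))).eventually_ge_atTop B).exists
  have hδ : (0 : ℝ) < 1 / (36 * ((K : ℝ) + 1) ^ 2) := by positivity
  filter_upwards [Ioo_mem_nhdsGT hδ] with ℓ hℓ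
  obtain ⟨hℓ, hℓδ⟩ := hℓ
  set y : ℝ := 1 / (36 * ℓ) with hy
  have hy0 : 0 ≤ y := by positivity
  have hyℓ : 36 * y * ℓ = 1 := by
    rw [hy]
    field_simp
  have hKy : ((K : ℝ) + 1) ^ 2 ≤ y := by
    rw [lt_div_iff₀ (by positivity)] at hℓδ
    rw [hy, le_div_iff₀ (by positivity)]
    linarith
  have hKN : K + 1 ≤ ⌊√y⌋₊ := Nat.le_floor (Real.le_sqrt_of_sq_le (by push_cast; exact hKy))
  have hfloor : (⌊√y⌋₊ : ℝ) ^ 2 ≤ y :=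
    (Real.le_sqrt (Nat.cast_nonneg _) hy0).1 (Nat.floor_le (Real.sqrt_nonneg y))
  have hceil : y ≤ ((⌊√y⌋₊ : ℝ) + 1) ^ 2 :=
    (Real.sqrt_le_left (by positivity)).1 (Nat.lt_floor_add_one _).le
  exact hK.trans (flatnessSF_ge (N := ⌊√y⌋₊) (by omega) (by omega) (by nlinarith) (by nlinarith))
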